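/- arXiv:2011.00276 — 2 statements merged into one kernel-verified Lean document; each statement's English description precedes it below -/
import Mathlib

section
/- Focusing case on the line, boundedness and negativity of the ground state level: let p ∈ (2,6), α > 0 and μ ∈ (0, μ_ℝ). Then the NLS energy E_α is bounded from below on H¹_μ(ℝ), and its infimum ℰ_α(μ, ℝ) is strictly negative; that is, there exists m ∈ ℝ with m < 0 such that E_α(u) ≥ m for all u ∈ H¹_μ(ℝ), and there exists u ∈ H¹_μ(ℝ) with E_α(u) < 0. -/
open MeasureTheory Real Set Filter

/-- Membership in `H¹(ℝ)`: `u` is differentiable with derivative `u'`,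
and both `u` and `u'` are square-integrable on `ℝ`. -/
def H1line (u u' : ℝ → ℝ) : Prop :=
  (∀ x, HasDerivAt u (u' x) x) ∧
  Integrable (fun x => (u x) ^ 2) ∧
  Integrable (fun x => (u' x) ^ 2)

/-- The NLS energy with combined nonlinearities
`E_α(u) = ∫_ℝ (½|u'|² − (1/6)|u|⁶ − (α/p)|u|^p)`. -/
noncomputable def Eline (p α : ℝ) (u u' : ℝ → ℝ) : ℝ :=
  ∫ x, (1 / 2 * (u' x) ^ 2 - 1 / 6 * |u x| ^ 6 - α / p * |u x| ^ p)

namespace H1line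

variable {u u' : ℝ → ℝ}

theorem continuous (h : H1line u u') : Continuous u :=
  continuous_iff_continuousAt.2 fun x => (h.1 x).continuousAt

theorem measurable_deriv (h : H1line u u') : Measurable u' := by
  have : u' = deriv u := funext fun x => (h.1 x).deriv.symm
  exact this ▸ _root_.measurable_deriv u

theorem integrable_mul_deriv (h : H1line u u') : Integrable (fun x => u x * u' x) := by
  refine (h.2.1.add h.2.2).mono'
    (h.continuous.measurable.mul h.measurable_deriv).aestronglyMeasurable (ae_of_all _ fun x => ?_)
  simp only [Pi.add_apply, norm_eq_abs, abs_le]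
  constructor <;> nlinarith [sq_nonneg (u x + u' x), sq_nonneg (u x - u' x)]

theorem hasDerivAt_sq (h : H1line u u') (x : ℝ) :
    HasDerivAt (fun y => (u y) ^ 2) (2 * (u x * u' x)) x :=
  ((h.1 x).pow 2).congr_deriv (by push_cast; ring)

theorem tendsto_sq_atTop (h : H1line u u') : Tendsto (fun x => (u x) ^ 2) atTop (nhds 0) :=
  tendsto_zero_of_hasDerivAt_of_integrableOn_Ioi (a := 0) (fun x _ => h.hasDerivAt_sq x)
    (h.integrable_mul_deriv.const_mul 2).integrableOn h.2.1.integrableOn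

theorem tendsto_sq_atBot (h : H1line u u') : Tendsto (fun x => (u x) ^ 2) atBot (nhds 0) :=
  tendsto_zero_of_hasDerivAt_of_integrableOn_Iic (a := 0) (fun x _ => h.hasDerivAt_sq x)
    (h.integrable_mul_deriv.const_mul 2).integrableOn h.2.1.integrableOn

theorem exists_sq_le (h : H1line u u') : ∃ B, 0 ≤ B ∧ ∀ x, (u x) ^ 2 ≤ B := by
  have hi := h.integrable_mul_deriv.const_mul 2
  refine ⟨∫ x, ‖2 * (u x * u' x)‖, integral_nonneg fun _ => norm_nonneg _, fun x => ?_⟩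
  have hx := integral_Iic_of_hasDerivAt_of_tendsto' (a := x) (fun y _ => h.hasDerivAt_sq y)
    hi.integrableOn h.tendsto_sq_atBot
  rw [sub_zero] at hx
  rw [← hx]
  exact (le_abs_self _).trans ((norm_integral_le_integral_norm _).trans
    (setIntegral_le_integral hi.norm (ae_of_all _ fun _ => norm_nonneg _)))

theorem integrable_pow_six (h : H1line u u') : Integrable (fun x => (u x) ^ 6) := by
  obtain ⟨B, hB, hu⟩ := h.exists_sq_le
  refine (h.2.1.const_mul (B ^ 2)).mono' (h.continuous.pow 6).aestronglyMeasurable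
    (ae_of_all _ fun x => ?_)
  rw [norm_eq_abs, abs_of_nonneg (by positivity), show (u x) ^ 6 = ((u x) ^ 2) ^ 2 * (u x) ^ 2 by ring]
  gcongr
  exact hu x

/-- Substituting the cumulative mass for the space variable turns this Gagliardo–Nirenberg
inequality into Wirtinger's inequality on `[0, μ]`. -/
theorem sq_mul_integral_pow_six_le (h : H1line u u') {κ : ℝ} (hκ : 0 < κ)
    (hκu : κ * ∫ x, (u x) ^ 2 < π) :
    κ ^ 2 * ∫ x, (u x) ^ 6 ≤ 4 * ∫ x, (u' x) ^ 2 := by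
  obtain ⟨B, hB, hu⟩ := h.exists_sq_le
  set μ := ∫ x, (u x) ^ 2 with hμ
  have hμ0 : 0 ≤ μ := integral_nonneg fun x => sq_nonneg _
  set m : ℝ → ℝ := fun x => ∫ y in Iic x, (u y) ^ 2 with hm
  have hm0 (x) : 0 ≤ m x := integral_nonneg fun x => sq_nonneg _
  have hmμ (x) : m x ≤ μ := setIntegral_le_integral h.2.1 (ae_of_all _ fun _ => sq_nonneg _)
  have hmd (x) : HasDerivAt m ((u x) ^ 2) x := by
    have h1 := ((h.continuous.pow 2).integral_hasStrictDerivAt 0 x).hasDerivAt.const_add (m 0)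
    refine h1.congr_of_eventuallyEq (Eventually.of_forall fun y => ?_)
    have := intervalIntegral.integral_Iic_sub_Iic (a := 0) (b := y)
      h.2.1.integrableOn h.2.1.integrableOn
    change m y = m 0 + ∫ z in (0 : ℝ)..y, (u z) ^ 2
    rw [← this]
    ring
  set θ : ℝ → ℝ := fun x => κ * (m x - μ / 2) with hθ
  have hθd (x) : HasDerivAt θ (κ * (u x) ^ 2) x := ((hmd x).sub_const _).const_mul κ
  have hθabs (x) : |θ x| ≤ κ * μ / 2 := by
    rw [abs_le]
    constructor <;> simp only [hθ] <;> nlinarith [hm0 x, hmμ x]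
  set c := cos (κ * μ / 2) with hc
  have hc0 : 0 < c := cos_pos_of_mem_Ioo ⟨by nlinarith [mul_nonneg hκ.le hμ0, pi_pos], by linarith⟩
  have hcos (x) : c ≤ cos (θ x) := by
    rw [← cos_abs (θ x)]
    exact cos_le_cos_of_nonneg_of_le_pi (abs_nonneg _) (by linarith [pi_pos]) (hθabs x)
  have hcos0 (x) : 0 < cos (θ x) := hc0.trans_le (hcos x)
  have hθc : Continuous θ := continuous_iff_continuousAt.2 fun x => (hθd x).continuousAt
  have htanc : Continuous fun x => tan (θ x) := by
    simp only [tan_eq_sin_div_cos]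
    exact (continuous_sin.comp hθc).div (continuous_cos.comp hθc) fun x => (hcos0 x).ne'
  have htan (x) : |tan (θ x)| ≤ 1 / c := by
    rw [tan_eq_sin_div_cos, abs_div, abs_of_pos (hcos0 x)]
    gcongr
    exacts [abs_sin_le_one _, hcos x]
  have hsec (x) : 1 / cos (θ x) ^ 2 = 1 + tan (θ x) ^ 2 := by
    have := (hcos0 x).ne'
    rw [tan_eq_sin_div_cos]
    field_simp
    linarith [sin_sq_add_cos_sq (θ x)]
  have hGd (x) : HasDerivAt (fun y => ((u y) ^ 2) ^ 2 * tan (θ y))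
      (4 * (u x) ^ 2 * tan (θ x) * (u x * u' x) + κ * (1 + tan (θ x) ^ 2) * (u x) ^ 6) x := by
    have h1 := ((h.hasDerivAt_sq x).pow 2).mul ((hasDerivAt_tan (hcos0 x).ne').comp x (hθd x))
    rw [hsec] at h1
    refine h1.congr_deriv ?_
    push_cast
    simp only [Function.comp_apply, Pi.pow_apply]
    ring
  have hG0 {l : Filter ℝ} (hl : Tendsto (fun x => (u x) ^ 2) l (nhds 0)) :
      Tendsto (fun y => ((u y) ^ 2) ^ 2 * tan (θ y)) l (nhds 0) := by
    have h2 : Tendsto (fun x => ((u x) ^ 2) ^ 2) l (nhds 0) := by simpa using hl.pow 2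
    refine h2.zero_mul_isBoundedUnder_le
      (isBoundedUnder_of ⟨1 / c, fun x => by simpa using htan x⟩)
  have hG1 : Integrable fun x => 4 * (u x) ^ 2 * tan (θ x) * (u x * u' x) := by
    refine h.integrable_mul_deriv.bdd_mul (c := 4 * B * (1 / c))
      (((h.continuous.pow 2).const_mul 4).mul htanc).aestronglyMeasurable (ae_of_all _ fun x => ?_)
    rw [norm_eq_abs, abs_mul, abs_of_nonneg (by positivity : 0 ≤ 4 * (u x) ^ 2)]
    gcongr
    exacts [hu x, htan x]
  have hG2 : Integrable fun x => κ * (1 + tan (θ x) ^ 2) * (u x) ^ 6 := by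
    refine h.integrable_pow_six.bdd_mul (c := κ * (1 + (1 / c) ^ 2))
      (((htanc.pow 2).const_add 1).const_mul κ).aestronglyMeasurable (ae_of_all _ fun x => ?_)
    rw [norm_eq_abs, abs_of_nonneg (by positivity), ← sq_abs (tan _)]
    gcongr
    exact htan x
  have hGi : Integrable fun x => 4 * (u x) ^ 2 * tan (θ x) * (u x * u' x)
      + κ * (1 + tan (θ x) ^ 2) * (u x) ^ 6 := hG1.add hG2
  have hint := integral_of_hasDerivAt_of_tendsto hGd hGi (hG0 h.tendsto_sq_atBot)
    (hG0 h.tendsto_sq_atTop)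
  have hmono := integral_mono (h.integrable_pow_six.const_mul (κ ^ 2))
    ((h.2.2.const_mul 4).add (hGi.const_mul κ)) fun x => by
      simp only [Pi.add_apply]
      nlinarith [sq_nonneg (2 * u' x + κ * tan (θ x) * (u x) ^ 3)]
  simp only [Pi.add_apply] at hmono
  rw [integral_add (h.2.2.const_mul 4) (hGi.const_mul κ), integral_const_mul, integral_const_mul,
    integral_const_mul, hint] at hmono
  linarith

end H1line

theorem exists_abs_rpow_le {p : ℝ} (hp : 2 < p) (hp' : p < 6) {ε : ℝ} (hε : 0 < ε) :
    ∃ C > 0, ∀ t : ℝ, |t| ^ p ≤ ε * t ^ 6 + C * t ^ 2 := by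
  obtain ⟨R, hRε, hR⟩ := (((tendsto_rpow_neg_atTop (sub_pos.2 hp')).eventually
    (eventually_le_nhds hε)).and (eventually_gt_atTop 0)).exists
  refine ⟨R ^ (p - 2), by positivity, fun t => ?_⟩
  rcases eq_or_ne t 0 with rfl | ht
  · simp [zero_rpow (by linarith : p ≠ 0)]
  have ht0 : 0 < |t| := abs_pos.2 ht
  rcases le_total R |t| with hRt | hRt
  · have h1 : |t| ^ p = |t| ^ (-(6 - p)) * t ^ 6 := by
      rw [← Even.pow_abs (by decide : Even 6) t, ← rpow_natCast, ← rpow_add ht0]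
      norm_num
    rw [h1]
    have h2 : |t| ^ (-(6 - p)) ≤ ε :=
      (rpow_le_rpow_of_nonpos hR hRt (by linarith)).trans hRε
    have : 0 ≤ R ^ (p - 2) * t ^ 2 := by positivity
    nlinarith [mul_le_mul_of_nonneg_right h2 (by positivity : 0 ≤ t ^ 6)]
  · have h1 : |t| ^ p = |t| ^ (p - 2) * t ^ 2 := by
      rw [← sq_abs t, ← rpow_natCast, ← rpow_add ht0]
      norm_num
    rw [h1]
    have h2 : |t| ^ (p - 2) ≤ R ^ (p - 2) := rpow_le_rpow ht0.le hRt (by linarith)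
    have : 0 ≤ ε * t ^ 6 := by positivity
    nlinarith [mul_le_mul_of_nonneg_right h2 (sq_nonneg t)]

theorem H1line.integrable_abs_rpow {u u' : ℝ → ℝ} (h : H1line u u') {p : ℝ}
    (hp : 2 < p) (hp' : p < 6) : Integrable (fun x => |u x| ^ p) := by
  obtain ⟨C, -, hC⟩ := exists_abs_rpow_le hp hp' one_pos
  refine ((h.integrable_pow_six.const_mul 1).add (h.2.1.const_mul C)).mono'
    (h.continuous.abs.rpow_const fun x => Or.inr (by linarith)).aestronglyMeasurable
    (ae_of_all _ fun x => ?_)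
  rw [norm_eq_abs, abs_of_nonneg (by positivity)]
  exact hC (u x)

theorem H1line.Eline_eq {u u' : ℝ → ℝ} (h : H1line u u') {p : ℝ}
    (hp : 2 < p) (hp' : p < 6) (α : ℝ) :
    Eline p α u u' = 1 / 2 * (∫ x, (u' x) ^ 2) - 1 / 6 * (∫ x, (u x) ^ 6)
      - α / p * ∫ x, |u x| ^ p := by
  have h1 := h.2.2.const_mul (1 / 2)
  have h2 := h.integrable_pow_six.const_mul (1 / 6)
  have h12 : Integrable fun x => 1 / 2 * (u' x) ^ 2 - 1 / 6 * (u x) ^ 6 := h1.sub h2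
  have h3 := (h.integrable_abs_rpow hp hp').const_mul (α / p)
  simp only [Eline, Even.pow_abs (by decide : Even 6)]
  rw [integral_sub h12 h3, integral_sub h1 h2, integral_const_mul, integral_const_mul,
    integral_const_mul]

theorem exists_neg_le_Eline {p α μ : ℝ} (hp : 2 < p) (hp' : p < 6) (hα : 0 < α) (hμ : 0 < μ)
    (hμR : μ < π * √3 / 2) :
    ∃ m < 0, ∀ u u' : ℝ → ℝ, H1line u u' → (∫ x, (u x) ^ 2) = μ → m ≤ Eline p α u u' := by
  obtain ⟨κ, hκ, hκμ⟩ : ∃ κ, 2 / √3 < κ ∧ κ < π / μ := exists_between <| by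
    rw [div_lt_div_iff₀ (by positivity) hμ]
    linarith
  have hκ0 : 0 < κ := lt_trans (by positivity) hκ
  have hκsq : 4 / 3 < κ ^ 2 := by
    have := pow_lt_pow_left₀ hκ (by positivity) two_ne_zero
    rw [div_pow, sq_sqrt (by norm_num)] at this
    linarith
  have hαp : 0 < α / p := by positivity
  obtain ⟨C, hC, hle⟩ := exists_abs_rpow_le hp hp' (ε := (κ ^ 2 / 8 - 1 / 6) / (α / p))
    (div_pos (by linarith) hαp)
  refine ⟨-(α / p * C * μ), by simp only [neg_neg_iff_pos]; positivity, fun u u' h hu => ?_⟩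
  have hGN := h.sq_mul_integral_pow_six_le hκ0 (by rw [hu]; exact (lt_div_iff₀ hμ).1 hκμ)
  have hpint := integral_mono (h.integrable_abs_rpow hp hp')
    ((h.integrable_pow_six.const_mul _).add (h.2.1.const_mul C)) fun x => hle (u x)
  simp only [Pi.add_apply] at hpint
  rw [integral_add (h.integrable_pow_six.const_mul _) (h.2.1.const_mul C), integral_const_mul,
    integral_const_mul, hu] at hpint
  have hpint' := mul_le_mul_of_nonneg_left hpint hαp.le
  rw [mul_add, ← mul_assoc, mul_div_cancel₀ _ hαp.ne', ← mul_assoc] at hpint'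
  rw [h.Eline_eq hp hp']
  linarith

theorem H1line.scale {w w' : ℝ → ℝ} (h : H1line w w') {l : ℝ} (hl : 0 < l) :
    H1line (fun x => √l * w (l * x)) (fun x => √l * (l * w' (l * x))) := by
  refine ⟨fun x => ?_, ?_, ?_⟩
  · have := ((h.1 (l * x)).comp x ((hasDerivAt_id x).const_mul l)).const_mul (√l)
    exact this.congr_deriv (by ring)
  · simp only [mul_pow]
    exact (h.2.1.comp_mul_left' hl.ne').const_mul _
  · simp only [mul_pow]
    exact ((h.2.2.comp_mul_left' hl.ne').const_mul _).const_mul _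

theorem exists_H1line_integral_sq_eq {μ : ℝ} (hμ : 0 < μ) :
    ∃ w w' : ℝ → ℝ, H1line w w' ∧ (∫ x, (w x) ^ 2) = μ ∧ ∀ x, w x ≠ 0 := by
  set J := ∫ x : ℝ, exp (-2 * x ^ 2) with hJ
  have hJ0 : 0 < J := by
    rw [hJ, integral_gaussian]
    positivity
  have hA : 0 < μ / J := div_pos hμ hJ0
  have hsq (x : ℝ) : exp (-x ^ 2) ^ 2 = exp (-2 * x ^ 2) := by
    rw [← exp_nat_mul]
    congr 1
    push_cast
    ring
  refine ⟨fun x => √(μ / J) * exp (-x ^ 2), fun x => √(μ / J) * (exp (-x ^ 2) * (-(2 * x))),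
    ⟨fun x => ?_, ?_, ?_⟩, ?_, fun x => by positivity⟩
  · have := ((hasDerivAt_pow 2 x).neg.exp).const_mul √(μ / J)
    simpa using this
  · simp only [mul_pow, hsq]
    exact (integrable_exp_neg_mul_sq two_pos).const_mul _
  · have h1 := (integrable_rpow_mul_exp_neg_mul_sq two_pos (s := 2) (by norm_num)).const_mul
      (4 * (μ / J))
    refine h1.congr (ae_of_all _ fun x => ?_)
    simp only [mul_pow, hsq, sq_sqrt hA.le, rpow_two]
    ring
  · simp only [mul_pow, hsq, sq_sqrt hA.le]
    rw [integral_const_mul]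
    exact div_mul_cancel₀ _ hJ0.ne'

theorem exists_Eline_neg {p α μ : ℝ} (hp : 2 < p) (hp' : p < 6) (hα : 0 < α) (hμ : 0 < μ) :
    ∃ u u' : ℝ → ℝ, H1line u u' ∧ (∫ x, (u x) ^ 2) = μ ∧ Eline p α u u' < 0 := by
  obtain ⟨w, w', h, hw, hw0⟩ := exists_H1line_integral_sq_eq hμ
  set T := ∫ x, (w' x) ^ 2 with hT
  have hP : 0 < ∫ x, |w x| ^ p := by
    rw [integral_pos_iff_support_of_nonneg (fun x => by positivity) (h.integrable_abs_rpow hp hp')]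
    have : Function.support (fun x => |w x| ^ p) = univ :=
      eq_univ_of_forall fun x => (rpow_pos_of_pos (abs_pos.2 (hw0 x)) p).ne'
    simp [this]
  set P := ∫ x, |w x| ^ p with hPdef
  have hlim : Tendsto (fun l : ℝ => 1 / 2 * l ^ (3 - p / 2) * T) (nhdsWithin 0 (Ioi 0))
      (nhds 0) := by
    have : Tendsto (fun l : ℝ => l ^ (3 - p / 2)) (nhds 0) (nhds 0) := by
      have := (continuousAt_rpow_const 0 (3 - p / 2) (Or.inr (by linarith))).tendsto
      rwa [zero_rpow (by linarith)] at this
    have h := ((this.const_mul (1 / 2)).mul_const T).mono_left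
      (nhdsWithin_le_nhds (s := Ioi 0))
    rwa [mul_zero, zero_mul] at h
  obtain ⟨l, hlT, hl⟩ := ((hlim.eventually (gt_mem_nhds
    (by positivity : 0 < α / p * P))).and self_mem_nhdsWithin).exists
  have hl : 0 < l := hl
  have hs := h.scale hl
  refine ⟨_, _, hs, ?_, ?_⟩
  · simp only [mul_pow, sq_sqrt hl.le]
    rw [integral_const_mul, Measure.integral_comp_mul_left (fun x => (w x) ^ 2), hw, smul_eq_mul,
      abs_of_pos (inv_pos.2 hl)]
    field_simp
  · have h1 : ∫ x, (√l * (l * w' (l * x))) ^ 2 = l ^ 2 * T := by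
      simp only [mul_pow, sq_sqrt hl.le]
      rw [integral_const_mul, integral_const_mul,
        Measure.integral_comp_mul_left (fun x => (w' x) ^ 2), smul_eq_mul,
        abs_of_pos (inv_pos.2 hl), ← hT]
      field_simp
    have h2 : ∫ x, |√l * w (l * x)| ^ p = l ^ (p / 2 - 1) * P := by
      simp only [abs_mul, mul_rpow (abs_nonneg _) (abs_nonneg _)]
      rw [integral_const_mul, Measure.integral_comp_mul_left (fun x => |w x| ^ p), smul_eq_mul,
        abs_of_pos (inv_pos.2 hl), abs_of_nonneg (sqrt_nonneg l), sqrt_eq_rpow, ← rpow_mul hl.le,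
        rpow_sub_one hl.ne', ← hPdef]
      ring_nf
    have h3 : 0 ≤ ∫ x, (√l * w (l * x)) ^ 6 := integral_nonneg fun x => by positivity
    have h4 : l ^ 2 = l ^ (p / 2 - 1) * l ^ (3 - p / 2) := by
      rw [← rpow_add hl, ← rpow_two]
      congr 1
      ring
    rw [hs.Eline_eq hp hp', h1, h2, h4]
    have := mul_lt_mul_of_pos_left hlT (rpow_pos_of_pos hl (p / 2 - 1))
    linarith

/-- Focusing case on the line: for `p ∈ (2,6)`, `α > 0` and `μ ∈ (0, μ_ℝ)`,
the energy `E_α` is bounded from below on `H¹_μ(ℝ)` by a strictly negative constant `m`,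
and some `u ∈ H¹_μ(ℝ)` has strictly negative energy. -/
theorem focusing_bounded_below_negative_line (p α μ : ℝ)
    (hp : 2 < p) (hp' : p < 6) (hα : 0 < α)
    (hμ : 0 < μ) (hμR : μ < Real.pi * Real.sqrt 3 / 2) :
    ∃ m : ℝ, m < 0 ∧
      (∀ u u' : ℝ → ℝ, H1line u u' → (∫ x, (u x) ^ 2) = μ → m ≤ Eline p α u u') ∧
      (∃ u u' : ℝ → ℝ, H1line u u' ∧ (∫ x, (u x) ^ 2) = μ ∧ Eline p α u u' < 0) := by
  obtain ⟨m, hm, hle⟩ := exists_neg_le_Eline hp hp' hα hμ hμR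
  exact ⟨m, hm, hle, exists_Eline_neg hp hp' hα hμ⟩
end

section
/- Focusing case on the line, unboundedness at and above the critical mass: let p ∈ (2,6), α > 0 and μ ≥ μ_ℝ. Then the NLS energy E_α is unbounded from below on H¹_μ(ℝ): for every M > 0 there exists u ∈ H¹_μ(ℝ) with E_α(u) < −M. -/
open MeasureTheory Real Set Filter

theorem one_add_sq_div_four_le_cosh (x : ℝ) : (1 + x ^ 2) / 4 ≤ cosh x := by
  have h := quadratic_le_exp_of_nonneg (abs_nonneg x)
  have h' := exp_pos (-|x|)
  have h0 := abs_nonneg x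
  have hs := sq_abs x
  rw [← cosh_abs, cosh_eq]
  nlinarith

theorem integrable_inv_cosh_rpow {s : ℝ} (hs : 1 ≤ s) :
    Integrable (fun x : ℝ => (cosh x)⁻¹ ^ s) := by
  have hc : Continuous fun x : ℝ => (cosh x)⁻¹ ^ s :=
    (continuous_cosh.inv₀ fun x => (cosh_pos x).ne').rpow_const fun _ => Or.inr (by linarith)
  refine (integrable_inv_one_add_sq.const_mul 4).mono' hc.aestronglyMeasurable
    (Eventually.of_forall fun x => ?_)
  have h0 : 0 < (cosh x)⁻¹ := inv_pos.2 (cosh_pos x)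
  rw [norm_of_nonneg (rpow_nonneg h0.le s)]
  calc (cosh x)⁻¹ ^ s ≤ (cosh x)⁻¹ ^ (1 : ℝ) :=
        rpow_le_rpow_of_exponent_ge h0 (inv_le_one_of_one_le₀ (one_le_cosh x)) hs
    _ = (cosh x)⁻¹ := rpow_one _
    _ ≤ ((1 + x ^ 2) / 4)⁻¹ := inv_anti₀ (by positivity) (one_add_sq_div_four_le_cosh x)
    _ = 4 * (1 + x ^ 2)⁻¹ := by rw [inv_div, div_eq_mul_inv]

theorem integral_inv_cosh_rpow_pos {s : ℝ} (hs : 1 ≤ s) :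
    0 < ∫ x : ℝ, (cosh x)⁻¹ ^ s := by
  have hpos : ∀ x : ℝ, 0 < (cosh x)⁻¹ ^ s := fun x => rpow_pos_of_pos (inv_pos.2 (cosh_pos x)) s
  rw [integral_pos_iff_support_of_nonneg (fun x => (hpos x).le) (integrable_inv_cosh_rpow hs)]
  have : Function.support (fun x : ℝ => (cosh x)⁻¹ ^ s) = univ :=
    eq_univ_of_forall fun x => (hpos x).ne'
  simp [this]

theorem integrable_inv_cosh : Integrable (fun x : ℝ => (cosh x)⁻¹) := by
  simpa using integrable_inv_cosh_rpow le_rfl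

theorem integrable_inv_cosh_cube : Integrable (fun x : ℝ => (cosh x)⁻¹ ^ 3) := by
  exact_mod_cast integrable_inv_cosh_rpow (s := (3 : ℕ)) (by norm_num)

theorem tendsto_sinh_atTop_atTop : Tendsto sinh atTop atTop :=
  tendsto_atTop_mono' _ ((eventually_ge_atTop 0).mono fun _ hx => self_le_sinh_iff.2 hx) tendsto_id

theorem tendsto_sinh_atBot_atBot : Tendsto sinh atBot atBot :=
  tendsto_atBot_mono' _ ((eventually_le_atBot 0).mono fun _ hx => sinh_le_self_iff.2 hx) tendsto_id

theorem integral_inv_cosh : ∫ x : ℝ, (cosh x)⁻¹ = π := by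
  have hd : ∀ x : ℝ, HasDerivAt (fun x => arctan (sinh x)) (cosh x)⁻¹ x := fun x => by
    convert (hasDerivAt_sinh x).arctan using 1
    have := (cosh_pos x).ne'
    rw [add_comm, ← cosh_sq]
    field_simp
  rw [integral_of_hasDerivAt_of_tendsto hd integrable_inv_cosh
    ((tendsto_nhds_of_tendsto_nhdsWithin tendsto_arctan_atBot).comp tendsto_sinh_atBot_atBot)
    ((tendsto_nhds_of_tendsto_nhdsWithin tendsto_arctan_atTop).comp tendsto_sinh_atTop_atTop)]
  ring

theorem integral_inv_cosh_cube : ∫ x : ℝ, (cosh x)⁻¹ ^ 3 = π / 2 := by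
  have hd : ∀ x : ℝ, HasDerivAt (fun x => sinh x / cosh x ^ 2)
      (2 * (cosh x)⁻¹ ^ 3 - (cosh x)⁻¹) x := fun x => by
    have hne := (cosh_pos x).ne'
    refine ((hasDerivAt_sinh x).div ((hasDerivAt_cosh x).pow 2) (pow_ne_zero 2 hne)).congr_deriv ?_
    have := sinh_sq x
    simp only [Pi.pow_apply, Nat.cast_ofNat]
    field_simp
    linear_combination (-2 * cosh x) * this
  have hinv : ∀ l : Filter ℝ, Tendsto (fun x : ℝ => |x|) l atTop →
      Tendsto (fun x => sinh x / cosh x ^ 2) l (nhds 0) := fun l hl => by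
    have hcosh : Tendsto (fun x => cosh x) l atTop :=
      tendsto_atTop_mono (fun x => by
        have := one_add_sq_div_four_le_cosh x
        have := sq_abs x
        nlinarith [sq_nonneg (|x| - 1)]) (hl.atTop_div_const two_pos)
    refine squeeze_zero_norm (fun x => ?_) (tendsto_inv_atTop_zero.comp hcosh)
    have hp := cosh_pos x
    have habs : |sinh x| ≤ cosh x := abs_le_of_sq_le_sq (by rw [sinh_sq]; linarith) hp.le
    simp only [Function.comp]
    rw [norm_div, norm_eq_abs, norm_eq_abs, abs_of_pos (pow_pos hp 2), div_le_iff₀ (pow_pos hp 2)]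
    have : (cosh x)⁻¹ * cosh x ^ 2 = cosh x := by field_simp
    rwa [this]
  have h := integral_of_hasDerivAt_of_tendsto hd
    ((integrable_inv_cosh_cube.const_mul 2).sub integrable_inv_cosh)
    (hinv _ tendsto_abs_atBot_atTop) (hinv _ tendsto_abs_atTop_atTop)
  rw [integral_sub (integrable_inv_cosh_cube.const_mul 2) integrable_inv_cosh,
    integral_const_mul, integral_inv_cosh] at h
  linarith

/-- The rescaled quintic soliton profile `√(cL) · sech(Lx)^{1/2}`, of mass `cπ`. -/
noncomputable def soliton (c L x : ℝ) : ℝ := √(c * L) * √((cosh (L * x))⁻¹)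

/-- The derivative of `soliton c L`. -/
noncomputable def solitonDeriv (c L x : ℝ) : ℝ :=
  -(√(c * L) * (L * sinh (L * x) / (2 * cosh (L * x)) * √((cosh (L * x))⁻¹)))

theorem hasDerivAt_soliton (c L x : ℝ) :
    HasDerivAt (soliton c L) (solitonDeriv c L x) x := by
  have hp := cosh_pos (L * x)
  have h1 : HasDerivAt (fun x => cosh (L * x)) (sinh (L * x) * (L * 1)) x :=
    ((hasDerivAt_id x).const_mul L).cosh
  have h2 := ((h1.inv hp.ne').sqrt (inv_pos.2 hp).ne').const_mul √(c * L)
  refine h2.congr_deriv ?_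
  have hs : √(cosh (L * x))⁻¹ ^ 2 = (cosh (L * x))⁻¹ := sq_sqrt (inv_pos.2 hp).le
  have hs0 : 0 < √(cosh (L * x))⁻¹ := sqrt_pos.2 (inv_pos.2 hp)
  simp only [solitonDeriv, Pi.inv_apply]
  have hs' : √(cosh (L * x))⁻¹ ^ 2 * cosh (L * x) = 1 := by rw [hs]; field_simp
  generalize √(cosh (L * x))⁻¹ = s at *
  field_simp
  linear_combination (L * √(c * L) * sinh (L * x)) * hs'

section

variable {c L : ℝ}

theorem soliton_nonneg (x : ℝ) : 0 ≤ soliton c L x := by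
  unfold soliton; positivity

theorem soliton_sq (hc : 0 ≤ c) (hL : 0 ≤ L) (x : ℝ) :
    soliton c L x ^ 2 = c * L * (cosh (L * x))⁻¹ := by
  rw [soliton, mul_pow, sq_sqrt (by positivity), sq_sqrt (inv_pos.2 (cosh_pos _)).le]

theorem solitonDeriv_sq (hc : 0 ≤ c) (hL : 0 ≤ L) (x : ℝ) :
    solitonDeriv c L x ^ 2 =
      c * L ^ 3 / 4 * ((cosh (L * x))⁻¹ - (cosh (L * x))⁻¹ ^ 3) := by
  have hp := cosh_pos (L * x)
  rw [solitonDeriv, neg_sq, mul_pow, mul_pow, sq_sqrt (by positivity), sq_sqrt (inv_pos.2 hp).le]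
  have := sinh_sq (L * x)
  field_simp
  linear_combination (4 * c * L ^ 3) * this

theorem abs_soliton_pow_six (hc : 0 ≤ c) (hL : 0 ≤ L) (x : ℝ) :
    |soliton c L x| ^ 6 = (c * L) ^ 3 * (cosh (L * x))⁻¹ ^ 3 := by
  rw [show 6 = 2 * 3 from rfl, pow_mul, sq_abs, soliton_sq hc hL, mul_pow]

theorem abs_soliton_rpow (hc : 0 ≤ c) (hL : 0 ≤ L) (p x : ℝ) :
    |soliton c L x| ^ p = (c * L) ^ (p / 2) * (cosh (L * x))⁻¹ ^ (p / 2) := by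
  have h : |soliton c L x| ^ p = (soliton c L x ^ 2) ^ (p / 2) := by
    rw [abs_of_nonneg (soliton_nonneg x), ← rpow_natCast, ← rpow_mul (soliton_nonneg x)]
    congr 1
    push_cast
    ring
  rw [h, soliton_sq hc hL, mul_rpow (by positivity) (inv_pos.2 (cosh_pos _)).le]

theorem h1line_soliton (hc : 0 ≤ c) (hL : 0 < L) :
    H1line (soliton c L) (solitonDeriv c L) := by
  refine ⟨hasDerivAt_soliton c L, ?_, ?_⟩
  · simp_rw [soliton_sq hc hL.le]
    exact (integrable_inv_cosh.comp_mul_left' hL.ne').const_mul _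
  · simp_rw [solitonDeriv_sq hc hL.le]
    exact ((integrable_inv_cosh.sub integrable_inv_cosh_cube).comp_mul_left' hL.ne').const_mul _

theorem integral_soliton_sq (hc : 0 ≤ c) (hL : 0 < L) :
    ∫ x, soliton c L x ^ 2 = c * π := by
  simp_rw [soliton_sq hc hL.le]
  rw [integral_const_mul, Measure.integral_comp_mul_left (fun x => (cosh x)⁻¹) L,
    integral_inv_cosh, smul_eq_mul, abs_of_pos (inv_pos.2 hL)]
  field_simp

theorem eline_soliton {p : ℝ} (α : ℝ) (hp : 2 ≤ p) (hc : 0 ≤ c) (hL : 0 < L) :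
    Eline p α (soliton c L) (solitonDeriv c L) =
      c * π / 48 * (3 - 4 * c ^ 2) * L ^ 2 -
        α / p * (c ^ (p / 2) * ∫ x : ℝ, (cosh x)⁻¹ ^ (p / 2)) * L ^ (p / 2 - 1) := by
  set J := ∫ x : ℝ, (cosh x)⁻¹ ^ (p / 2) with hJ
  have i1 : Integrable fun x : ℝ =>
      1 / 2 * (c * L ^ 3 / 4) * ((cosh x)⁻¹ - (cosh x)⁻¹ ^ 3) :=
    (integrable_inv_cosh.sub integrable_inv_cosh_cube).const_mul _
  have i12 : Integrable fun x : ℝ =>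
      1 / 2 * (c * L ^ 3 / 4) * ((cosh x)⁻¹ - (cosh x)⁻¹ ^ 3) -
        1 / 6 * (c * L) ^ 3 * (cosh x)⁻¹ ^ 3 :=
    i1.sub (integrable_inv_cosh_cube.const_mul _)
  have i3 := (integrable_inv_cosh_rpow (s := p / 2) (by linarith)).const_mul
    (α / p * (c * L) ^ (p / 2))
  have hE := Measure.integral_comp_mul_left (fun y : ℝ =>
      1 / 2 * (c * L ^ 3 / 4) * ((cosh y)⁻¹ - (cosh y)⁻¹ ^ 3) -
        1 / 6 * (c * L) ^ 3 * (cosh y)⁻¹ ^ 3 -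
        α / p * (c * L) ^ (p / 2) * (cosh y)⁻¹ ^ (p / 2)) L
  simp only [Eline, solitonDeriv_sq hc hL.le, abs_soliton_pow_six hc hL.le,
    abs_soliton_rpow hc hL.le, ← mul_assoc] at hE ⊢
  rw [hE, integral_sub i12 i3,
    integral_sub i1 (integrable_inv_cosh_cube.const_mul _),
    integral_const_mul, integral_const_mul, integral_const_mul,
    integral_sub integrable_inv_cosh integrable_inv_cosh_cube, integral_inv_cosh,
    integral_inv_cosh_cube, ← hJ, smul_eq_mul, abs_of_pos (inv_pos.2 hL), mul_rpow hc hL.le,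
    rpow_sub_one hL.ne']
  field_simp
  ring

end

/-- Focusing case on the line, unboundedness at and above the critical mass:
for `p ∈ (2,6)`, `α > 0` and `μ ≥ μ_ℝ`, for every `M > 0` there exists
`u ∈ H¹_μ(ℝ)` with `E_α(u) < −M`. -/
theorem focusing_unbounded_line (p α μ : ℝ)
    (hp : 2 < p) (hp' : p < 6) (hα : 0 < α)
    (hμ : Real.pi * Real.sqrt 3 / 2 ≤ μ) :
    ∀ M : ℝ, 0 < M → ∃ u u' : ℝ → ℝ,
      H1line u u' ∧ (∫ x, (u x) ^ 2) = μ ∧ Eline p α u u' < -M := by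
  intro M _
  obtain ⟨c, rfl⟩ : ∃ c, μ = c * π := ⟨μ / π, (div_mul_cancel₀ μ pi_ne_zero).symm⟩
  have hc : √3 / 2 ≤ c := le_of_mul_le_mul_right (by linarith) pi_pos
  have h3 : 0 < √3 := by positivity
  have hc0 : 0 < c := by linarith
  have hc2 : 3 - 4 * c ^ 2 ≤ 0 := by
    nlinarith [sq_sqrt (show (0 : ℝ) ≤ 3 by norm_num)]
  have hK : 0 < α / p * (c ^ (p / 2) * ∫ x : ℝ, (cosh x)⁻¹ ^ (p / 2)) :=
    mul_pos (div_pos hα (by linarith))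
      (mul_pos (rpow_pos_of_pos hc0 _) (integral_inv_cosh_rpow_pos (by linarith)))
  obtain ⟨L, hLM, hL⟩ := (((tendsto_rpow_atTop (y := p / 2 - 1) (by linarith)).const_mul_atTop
    hK).eventually_gt_atTop M |>.and (eventually_gt_atTop 0)).exists
  refine ⟨soliton c L, solitonDeriv c L, h1line_soliton hc0.le hL,
    integral_soliton_sq hc0.le hL, ?_⟩
  rw [eline_soliton α hp.le hc0.le hL]
  have : c * π / 48 * (3 - 4 * c ^ 2) * L ^ 2 ≤ 0 :=
    mul_nonpos_of_nonpos_of_nonneg (mul_nonpos_of_nonneg_of_nonpos (by positivity) hc2)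
      (sq_nonneg L)
  linarith
end
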